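/- arXiv:1507.06684 — 2 statements merged into one kernel-verified Lean document; each statement's English description precedes it below -/
import Mathlib

section
/- If X is a Urysohn space, then |X| ≤ 2^{swL_c(X, 2^{χ(X)}) · χ(X)}. -/
open Cardinal Set

universe u

/-- Skew-λ Lindelöf degree of `A` in `X`. -/
noncomputable def skLrel (X : Type u) [TopologicalSpace X] (A : Set X) (lam : Cardinal.{u}) :
    Cardinal.{u} :=
  sInf {κ : Cardinal.{u} | ℵ₀ ≤ κ ∧
    ∀ 𝒰 : Set (Set X), (∀ U ∈ 𝒰, IsOpen U) → A ⊆ ⋃₀ 𝒰 →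
      ∃ 𝒱 ⊆ 𝒰, #↥𝒱 ≤ κ ∧ #↥(A \ ⋃₀ 𝒱) < lam}

/-- Skew-λ Lindelöf degree of `X`. -/
noncomputable def skL (X : Type u) [TopologicalSpace X] (lam : Cardinal.{u}) : Cardinal.{u} :=
  skLrel X Set.univ lam

/-- Lindelöf degree of `X`. -/
noncomputable def Ldeg (X : Type u) [TopologicalSpace X] : Cardinal.{u} :=
  sInf {κ : Cardinal.{u} | ℵ₀ ≤ κ ∧
    ∀ 𝒰 : Set (Set X), (∀ U ∈ 𝒰, IsOpen U) → ⋃₀ 𝒰 = Set.univ →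
      ∃ 𝒱 ⊆ 𝒰, #↥𝒱 ≤ κ ∧ ⋃₀ 𝒱 = Set.univ}

/-- Pseudocharacter of `X`. -/
noncomputable def psi (X : Type u) [TopologicalSpace X] : Cardinal.{u} :=
  sInf {κ : Cardinal.{u} | ℵ₀ ≤ κ ∧
    ∀ x : X, ∃ 𝒱 : Set (Set X), (∀ V ∈ 𝒱, IsOpen V) ∧ #↥𝒱 ≤ κ ∧ ⋂₀ 𝒱 = {x}}

/-- Closed pseudocharacter of `X`. -/
noncomputable def psic (X : Type u) [TopologicalSpace X] : Cardinal.{u} :=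
  sInf {κ : Cardinal.{u} | ℵ₀ ≤ κ ∧
    ∀ x : X, ∃ 𝒱 : Set (Set X), (∀ V ∈ 𝒱, IsOpen V ∧ x ∈ V) ∧ #↥𝒱 ≤ κ ∧
      (⋂ V ∈ 𝒱, closure V) = {x}}

/-- Tightness of `X`. -/
noncomputable def tight (X : Type u) [TopologicalSpace X] : Cardinal.{u} :=
  sInf {κ : Cardinal.{u} | ℵ₀ ≤ κ ∧
    ∀ (A : Set X) (x : X), x ∈ closure A → ∃ B ⊆ A, #↥B ≤ κ ∧ x ∈ closure B}

/-- Character of `X`. -/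
noncomputable def charDeg (X : Type u) [TopologicalSpace X] : Cardinal.{u} :=
  sInf {κ : Cardinal.{u} | ℵ₀ ≤ κ ∧
    ∀ x : X, ∃ ℬ : Set (Set X), (∀ B ∈ ℬ, IsOpen B ∧ x ∈ B) ∧ #↥ℬ ≤ κ ∧
      ∀ U : Set X, IsOpen U → x ∈ U → ∃ B ∈ ℬ, B ⊆ U}

/-- Density of `X`. -/
noncomputable def dens (X : Type u) [TopologicalSpace X] : Cardinal.{u} :=
  sInf {κ : Cardinal.{u} | ℵ₀ ≤ κ ∧ ∃ D : Set X, Dense D ∧ #↥D ≤ κ}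

/-- θ-network weight of `X`. -/
noncomputable def nwTheta (X : Type u) [TopologicalSpace X] : Cardinal.{u} :=
  sInf {κ : Cardinal.{u} | ℵ₀ ≤ κ ∧
    ∃ 𝒩 : Set (Set X), 𝒩.Nonempty ∧ #↥𝒩 ≤ κ ∧
      ∀ (x : X) (U : Set X), IsOpen U → x ∈ U → ∃ N ∈ 𝒩, x ∈ N ∧ N ⊆ closure U}

/-- Skew-λ almost Lindelöf degree of `A` in `X`. -/
noncomputable def saLrel (X : Type u) [TopologicalSpace X] (A : Set X) (lam : Cardinal.{u}) :
    Cardinal.{u} :=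
  sInf {κ : Cardinal.{u} | ℵ₀ ≤ κ ∧
    ∀ 𝒰 : Set (Set X), (∀ U ∈ 𝒰, IsOpen U) → A ⊆ ⋃₀ 𝒰 →
      ∃ 𝒱 ⊆ 𝒰, #↥𝒱 ≤ κ ∧ #↥(A \ ⋃ V ∈ 𝒱, closure V) < lam}

/-- Skew-λ almost Lindelöf degree of `X`. -/
noncomputable def saL (X : Type u) [TopologicalSpace X] (lam : Cardinal.{u}) : Cardinal.{u} :=
  saLrel X Set.univ lam

/-- Skew-λ almost Lindelöf degree of `X` with respect to closed sets. -/
noncomputable def saLc (X : Type u) [TopologicalSpace X] (lam : Cardinal.{u}) : Cardinal.{u} :=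
  sSup {c : Cardinal.{u} | ∃ A : Set X, IsClosed A ∧ c = saLrel X A lam}

/-- κ-closure of a set. -/
def clk {X : Type u} [TopologicalSpace X] (κ : Cardinal.{u}) (A : Set X) : Set X :=
  ⋃ B ∈ {B : Set X | B ⊆ A ∧ #↥B ≤ κ}, closure B

/-- Skew-λ almost Lindelöf degree of `X` with respect to κ-closed sets. -/
noncomputable def saLk (X : Type u) [TopologicalSpace X] (κ lam : Cardinal.{u}) : Cardinal.{u} :=
  sSup {c : Cardinal.{u} | ∃ A : Set X, clk κ A = A ∧ c = saLrel X A lam}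

/-- Skew-λ weak Lindelöf degree of `A` in `X`. -/
noncomputable def swLrel (X : Type u) [TopologicalSpace X] (A : Set X) (lam : Cardinal.{u}) :
    Cardinal.{u} :=
  sInf {κ : Cardinal.{u} | ℵ₀ ≤ κ ∧
    ∀ 𝒰 : Set (Set X), (∀ U ∈ 𝒰, IsOpen U) → A ⊆ ⋃₀ 𝒰 →
      ∃ 𝒱 ⊆ 𝒰, #↥𝒱 ≤ κ ∧ #↥(A \ closure (⋃₀ 𝒱)) < lam}

/-- Skew-λ weak Lindelöf degree of `X`. -/
noncomputable def swL (X : Type u) [TopologicalSpace X] (lam : Cardinal.{u}) : Cardinal.{u} :=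
  swLrel X Set.univ lam

/-- Skew-λ weak Lindelöf degree of `X` with respect to closed sets. -/
noncomputable def swLc (X : Type u) [TopologicalSpace X] (lam : Cardinal.{u}) : Cardinal.{u} :=
  sSup {c : Cardinal.{u} | ∃ A : Set X, IsClosed A ∧ c = swLrel X A lam}

/-- Enumerate a small nonempty set. -/
theorem aux_enum {Y I : Type u} (p : Set Y) (hp : p.Nonempty) (h : #↥p ≤ #I) :
    ∃ g : I → Y, range g = p := by
  obtain ⟨e⟩ := h
  have : Nonempty p := hp.to_subtype
  refine ⟨fun i => (Function.invFun e i : p), ?_⟩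
  ext y
  constructor
  · rintro ⟨i, rfl⟩
    exact (Function.invFun e i).2
  · intro hy
    exact ⟨e ⟨y, hy⟩, by simp [Function.leftInverse_invFun e.injective _]⟩

theorem aux_select {Y I : Type u} [Nonempty Y] (lam : Cardinal.{u}) (hI : lam ≤ #I) (D : Set Y) :
    ∃ g : I → Y, (#↥D < lam → D ⊆ range g) ∧ (lam ≤ #↥D → lam ≤ #↥(D ∩ range g)) := by
  have key : ∀ p : Set Y, #↥p ≤ #I → ∃ g : I → Y, p ⊆ range g := by
    intro p h
    rcases p.eq_empty_or_nonempty with rfl | hp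
    · exact ⟨fun _ => Classical.arbitrary Y, by simp⟩
    · obtain ⟨g, hg⟩ := aux_enum p hp h
      exact ⟨g, hg.ge⟩
  by_cases hD : #↥D < lam
  · obtain ⟨g, hg⟩ := key D (hD.le.trans hI)
    exact ⟨g, fun _ => hg, fun h => absurd hD (not_lt.2 h)⟩
  · obtain ⟨p, hpD, hp⟩ := (Cardinal.le_mk_iff_exists_subset).1 (not_lt.1 hD)
    obtain ⟨g, hg⟩ := key p (hp.le.trans hI)
    refine ⟨g, fun h => absurd h hD, fun _ => ?_⟩
    rw [← hp]
    exact Cardinal.mk_le_mk_of_subset (subset_inter hpD hg)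

/-- Arity function for the closing-off argument. -/
def auxArity (T K : Type u) : Option T → Type u
  | none => PEmpty
  | some _ => K

/-- Evaluation of closing-off terms. -/
def auxEval {T K Y : Type u} (y0 : Y) (F : T → (K → Y) → Y) : WType (auxArity T K) → Y
  | ⟨none, _⟩ => y0
  | ⟨some t, f⟩ => F t (fun k => auxEval y0 F (f k))

theorem aux_close {T K Y : Type u} (hK : ℵ₀ ≤ #K) (hT : #T ≤ 2 ^ #K) (y0 : Y)
    (F : T → (K → Y) → Y) :
    ∃ H : Set Y, y0 ∈ H ∧ #↥H ≤ 2 ^ #K ∧ ∀ t (s : K → Y), (∀ k, s k ∈ H) → F t s ∈ H := by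
  refine ⟨range (auxEval y0 F), ⟨⟨none, PEmpty.elim⟩, by simp [auxEval]⟩, ?_, ?_⟩
  · refine Cardinal.mk_range_le.trans ?_
    have h2 : ℵ₀ ≤ (2 : Cardinal.{u}) ^ #K := hK.trans (Cardinal.cantor _).le
    have h3 : ((2 : Cardinal.{u}) ^ #K) ^ #K = 2 ^ #K := by
      rw [← Cardinal.power_mul, Cardinal.mul_eq_self hK]
    apply WType.cardinalMk_le_of_le
    refine (Cardinal.sum_le_sum (g := fun _ => (2 : Cardinal.{u}) ^ #K) _ ?_).trans ?_
    · intro a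
      cases a with
      | none =>
        have : #(auxArity T K none) = 0 := Cardinal.mk_pempty
        rw [this, Cardinal.power_zero]
        exact Cardinal.one_le_aleph0.trans h2
      | some t => exact h3.le
    · rw [Cardinal.sum_const', Cardinal.mk_option]
      exact Cardinal.mul_le_of_le h2
        (Cardinal.add_le_of_le h2 hT (Cardinal.one_le_aleph0.trans h2)) le_rfl
  · intro t s hs
    choose w hw using hs
    refine ⟨⟨some t, w⟩, ?_⟩
    simp only [auxEval]
    congr 1
    funext k
    exact hw k

theorem aux_main {X K : Type u} [TopologicalSpace X]
    (hU : ∀ x y : X, x ≠ y → ∃ U V : Set X, IsOpen U ∧ IsOpen V ∧ x ∈ U ∧ y ∈ V ∧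
      Disjoint (closure U) (closure V))
    (hK : ℵ₀ ≤ #K) (lam : Cardinal.{u}) (hlam : lam ≤ 2 ^ #K)
    (b : X → K → Set X) (hbo : ∀ x k, IsOpen (b x k)) (hbm : ∀ x k, x ∈ b x k)
    (hbb : ∀ x U, IsOpen U → x ∈ U → ∃ k, b x k ⊆ U)
    (hL : ∀ A : Set X, IsClosed A → ∀ 𝒰 : Set (Set X), (∀ U ∈ 𝒰, IsOpen U) → A ⊆ ⋃₀ 𝒰 →
      ∃ 𝒱 ⊆ 𝒰, #↥𝒱 ≤ #K ∧ #↥(A \ closure (⋃₀ 𝒱)) < lam) :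
    #X ≤ 2 ^ #K := by
  classical
  rcases isEmpty_or_nonempty X with hX | ⟨⟨y0⟩⟩
  · simp
  have : Nonempty X := ⟨y0⟩
  have hset : #(Set K) = 2 ^ #K := Cardinal.mk_set
  have h2 : ℵ₀ ≤ (2 : Cardinal.{u}) ^ #K := hK.trans (Cardinal.cantor _).le
  have hfun : #(K → Set K) = 2 ^ #K := by
    rw [← Cardinal.power_def, hset, ← Cardinal.power_mul, Cardinal.mul_eq_self hK]
  -- removed sets
  let D : (K → X) → (K → Set K) → Set X := fun s t =>
    (closure (⋃ j, ⋃ k ∈ t j, b (s j) k))ᶜ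
  have hsel := fun s t => aux_select (I := Set K) lam (hlam.trans hset.ge) (D s t)
  choose g hg1 hg2 using hsel
  -- theta-closure coding
  let P : (K → X) → (K → Set K) → X → Prop := fun s t q =>
    (∀ k, s k ∈ closure (b q k)) ∧ ∀ k, t k = {j | s j ∈ closure (b q k)}
  have hP : ∀ s t q q', P s t q → P s t q' → q = q' := by
    rintro s t q q' ⟨h1, h2⟩ ⟨h1', h2'⟩
    by_contra hne
    obtain ⟨U, V, hUo, hVo, hqU, hqV, hd⟩ := hU q q' hne
    obtain ⟨k, hk⟩ := hbb q U hUo hqU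
    obtain ⟨m, hm⟩ := hbb q' (b q' k ∩ V) ((hbo q' k).inter hVo) ⟨hbm q' k, hqV⟩
    have hs := h1' m
    have e1 : s m ∈ closure (b q' k) := closure_mono (hm.trans inter_subset_left) hs
    have e2 : s m ∈ closure V := closure_mono (hm.trans inter_subset_right) hs
    have e3 : m ∈ t k := by rw [h2' k]; exact e1
    rw [h2 k] at e3
    exact Set.disjoint_left.1 hd (closure_mono hk e3) e2
  let F : ((K → Set K) ⊕ ((K → Set K) × Set K)) → (K → X) → X := fun t s =>
    match t with
    | Sum.inl t => if h : ∃ q, P s t q then h.choose else y0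
    | Sum.inr (t, i) => g s t i
  obtain ⟨H, hy0, hHc, hH⟩ := aux_close (T := (K → Set K) ⊕ ((K → Set K) × Set K)) hK (by
    rw [Cardinal.mk_sum, Cardinal.mk_prod]
    simp only [Cardinal.lift_id, hfun, hset]
    exact Cardinal.add_le_of_le h2 le_rfl (Cardinal.mul_le_of_le h2 le_rfl le_rfl)) y0 F
  have hth : ∀ q, q ∉ H → ∃ k, Disjoint (closure (b q k)) H := by
    intro q hq
    by_contra hcon
    push Not at hcon
    have : ∀ k, ∃ x, x ∈ closure (b q k) ∧ x ∈ H := fun k => Set.not_disjoint_iff.1 (hcon k)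
    choose s hs1 hs2 using this
    apply hq
    have hF := hH (Sum.inl fun k => {j | s j ∈ closure (b q k)}) s hs2
    have hex : ∃ q', P s (fun k => {j | s j ∈ closure (b q k)}) q' := ⟨q, hs1, fun _ => rfl⟩
    have : F (Sum.inl fun k => {j | s j ∈ closure (b q k)}) s = q := by
      simp only [F]
      rw [dif_pos hex]
      exact hP _ _ _ _ hex.choose_spec ⟨hs1, fun _ => rfl⟩
    rwa [this] at hF
  have hclosed : IsClosed H := by
    rw [← isOpen_compl_iff, isOpen_iff_forall_mem_open]
    intro q hq
    obtain ⟨k, hk⟩ := hth q hq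
    exact ⟨b q k, fun x hx hxH => Set.disjoint_left.1 hk (subset_closure hx) hxH, hbo q k, hbm q k⟩
  suffices hall : ∀ q, q ∈ H by
    have : H = Set.univ := eq_univ_of_forall hall
    rw [this, Cardinal.mk_univ] at hHc
    exact hHc
  intro q
  by_contra hq
  obtain ⟨m, hm⟩ := hth q hq
  have : ∀ p : H, ∃ k, b p k ⊆ (closure (b q m))ᶜ := fun p =>
    hbb p _ isClosed_closure.isOpen_compl (fun h => Set.disjoint_left.1 hm h p.2)
  choose f hf using this
  obtain ⟨𝒱, h𝒱, h𝒱c, h𝒱l⟩ := hL H hclosed (range fun p : H => b p (f p))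
    (by rintro _ ⟨p, rfl⟩; exact hbo _ _)
    (fun p hp => ⟨_, ⟨⟨p, hp⟩, rfl⟩, hbm _ _⟩)
  have hrep : ∃ (s : K → X) (t : K → Set K), (∀ k, s k ∈ H) ∧
      ⋃₀ 𝒱 = ⋃ j, ⋃ k ∈ t j, b (s j) k := by
    rcases 𝒱.eq_empty_or_nonempty with rfl | hne
    · exact ⟨fun _ => y0, fun _ => ∅, fun _ => hy0, by simp⟩
    · obtain ⟨v, hv⟩ := aux_enum (I := K) 𝒱 hne h𝒱c
      have : ∀ j, ∃ p : H, b p (f p) = v j := fun j => h𝒱 (hv ▸ mem_range_self j)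
      choose p hp using this
      refine ⟨fun j => p j, fun j => {f (p j)}, fun j => (p j).2, ?_⟩
      rw [← hv, sUnion_range]
      simp [hp]
  obtain ⟨s, t, hs, hst⟩ := hrep
  have hDe : D s t = (closure (⋃₀ 𝒱))ᶜ := by simp only [D, hst]
  have hsub : range (g s t) ⊆ H := by
    rintro _ ⟨i, rfl⟩
    exact hH (Sum.inr (t, i)) s hs
  have hqD : q ∈ D s t := by
    rw [hDe]
    intro hqc
    obtain ⟨x, hx1, hx2⟩ := mem_closure_iff.1 hqc _ (hbo q m) (hbm q m)
    obtain ⟨V, hV, hxV⟩ := hx2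
    obtain ⟨p, rfl⟩ := h𝒱 hV
    exact hf p hxV (subset_closure hx1)
  by_cases hlt : #↥(D s t) < lam
  · exact hq (hsub (hg1 s t hlt hqD))
  · refine absurd h𝒱l (not_lt.2 ((hg2 s t (not_lt.1 hlt)).trans
      (Cardinal.mk_le_mk_of_subset ?_)))
    rintro x ⟨hx1, hx2⟩
    rw [hDe] at hx1
    exact ⟨hsub hx2, hx1⟩

theorem aux_swLrel_mem (X : Type u) [TopologicalSpace X] (A : Set X) (lam : Cardinal.{u})
    (hlam : 0 < lam) : swLrel X A lam ∈ {κ : Cardinal.{u} | ℵ₀ ≤ κ ∧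
    ∀ 𝒰 : Set (Set X), (∀ U ∈ 𝒰, IsOpen U) → A ⊆ ⋃₀ 𝒰 →
      ∃ 𝒱 ⊆ 𝒰, #↥𝒱 ≤ κ ∧ #↥(A \ closure (⋃₀ 𝒱)) < lam} := by
  apply csInf_mem
  refine ⟨max ℵ₀ #(Set X), le_max_left _ _, fun 𝒰 _ hA => ⟨𝒰, Subset.rfl,
    (Cardinal.mk_set_le _).trans (le_max_right _ _), ?_⟩⟩
  rw [Set.diff_eq_empty.2 (hA.trans subset_closure)]
  simpa using hlam

theorem aux_charDeg_mem (X : Type u) [TopologicalSpace X] :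
    charDeg X ∈ {κ : Cardinal.{u} | ℵ₀ ≤ κ ∧
    ∀ x : X, ∃ ℬ : Set (Set X), (∀ B ∈ ℬ, IsOpen B ∧ x ∈ B) ∧ #↥ℬ ≤ κ ∧
      ∀ U : Set X, IsOpen U → x ∈ U → ∃ B ∈ ℬ, B ⊆ U} := by
  apply csInf_mem
  exact ⟨max ℵ₀ #(Set X), le_max_left _ _, fun x => ⟨{B | IsOpen B ∧ x ∈ B}, fun _ h => h,
    (Cardinal.mk_set_le _).trans (le_max_right _ _), fun U h1 h2 => ⟨U, ⟨h1, h2⟩, Subset.rfl⟩⟩⟩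

/-- Theorem 5.3: if X is Urysohn, then |X| ≤ 2^{swL_c(X,2^{χ(X)})·χ(X)}. -/
theorem card_le_two_pow_swLc_of_urysohn {X : Type u} [TopologicalSpace X]
    (hU : ∀ x y : X, x ≠ y → ∃ U V : Set X, IsOpen U ∧ IsOpen V ∧ x ∈ U ∧ y ∈ V ∧
      Disjoint (closure U) (closure V)) :
    #X ≤ 2 ^ (swLc X (2 ^ charDeg X) * charDeg X) := by
  obtain ⟨hχ, hχb⟩ := aux_charDeg_mem X
  have hlam : (0 : Cardinal.{u}) < 2 ^ charDeg X :=
    lt_of_le_of_lt (Cardinal.zero_le _) (Cardinal.cantor _)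
  have hle : ∀ A : Set X, IsClosed A → swLrel X A (2 ^ charDeg X) ≤ swLc X (2 ^ charDeg X) := by
    intro A hA
    refine le_csSup ?_ ⟨A, hA, rfl⟩
    refine (Cardinal.bddAbove_range (fun A : Set X => swLrel X A (2 ^ charDeg X))).mono ?_
    rintro _ ⟨A, _, rfl⟩
    exact ⟨A, rfl⟩
  have hsw : ℵ₀ ≤ swLc X (2 ^ charDeg X) :=
    (aux_swLrel_mem X univ _ hlam).1.trans (hle univ isClosed_univ)
  have h1 : swLc X (2 ^ charDeg X) ≤ swLc X (2 ^ charDeg X) * charDeg X :=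
    Cardinal.le_mul_right (Cardinal.aleph0_pos.trans_le hχ).ne'
  have h2 : charDeg X ≤ swLc X (2 ^ charDeg X) * charDeg X :=
    Cardinal.le_mul_left (Cardinal.aleph0_pos.trans_le hsw).ne'
  generalize hκ : swLc X (2 ^ charDeg X) * charDeg X = κ at h1 h2 ⊢
  obtain ⟨K, rfl⟩ : ∃ K : Type u, #K = κ := ⟨κ.out, Cardinal.mk_out κ⟩
  have hb : ∀ x : X, ∃ v : K → Set X, (∀ k, IsOpen (v k) ∧ x ∈ v k) ∧
      ∀ U, IsOpen U → x ∈ U → ∃ k, v k ⊆ U := by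
    intro x
    obtain ⟨ℬ, hB1, hB2, hB3⟩ := hχb x
    obtain ⟨B0, hB0, _⟩ := hB3 univ isOpen_univ (mem_univ x)
    obtain ⟨v, hv⟩ := aux_enum (I := K) ℬ ⟨B0, hB0⟩ (hB2.trans h2)
    refine ⟨v, fun k => hB1 _ (hv ▸ mem_range_self k), fun U hUo hxU => ?_⟩
    obtain ⟨B, hB, hBU⟩ := hB3 U hUo hxU
    rw [← hv] at hB
    obtain ⟨k, rfl⟩ := hB
    exact ⟨k, hBU⟩
  choose b hb1 hb2 using hb
  refine aux_main hU (hχ.trans h2) (2 ^ charDeg X)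
    (Cardinal.power_le_power_left two_ne_zero h2) b (fun x k => (hb1 x k).1)
    (fun x k => (hb1 x k).2) hb2 ?_
  intro A hA 𝒰 h𝒰 hcov
  obtain ⟨𝒱, ha, hb, hc⟩ := (aux_swLrel_mem X A _ hlam).2 𝒰 h𝒰 hcov
  exact ⟨𝒱, ha, hb.trans ((hle A hA).trans h1), hc⟩
end

section
/- If X is a normal Hausdorff space, then |X| ≤ 2^{swL(X, 2^{χ(X)}) · χ(X)}. -/
open Cardinal Set

universe u

/-- Closing off under `2^#K` many `K`-ary operations. -/
theorem exists_closed_under {X K ι : Type u} [Infinite K] (hι : #ι ≤ 2 ^ #K) (p₀ : X)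
    (F : ι → (K → X) → X) :
    ∃ H : Set X, p₀ ∈ H ∧ #↥H ≤ 2 ^ #K ∧ ∀ i f, (∀ k, f k ∈ H) → F i f ∈ H := by
  classical
  let β : Option ι → Type u := fun o => Option.casesOn o PEmpty.{u+1} (fun _ => K)
  let ev : WType β → X := WType.elim X (fun x : Σ a : Option ι, β a → X =>
    match x with
    | ⟨none, _⟩ => p₀
    | ⟨some i, f⟩ => F i f)
  have hK : ℵ₀ ≤ #K := Cardinal.aleph0_le_mk K
  have hμ : ℵ₀ ≤ (2 : Cardinal.{u}) ^ #K := hK.trans (Cardinal.cantor _).le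
  have hcard : #(WType β) ≤ 2 ^ #K := by
    apply WType.cardinalMk_le_of_le'
    have h1 : ∀ a : Option ι, ((2 : Cardinal.{u}) ^ #K) ^ #(β a) ≤ 2 ^ #K := by
      intro a
      cases a with
      | none =>
        have : #(β none) = 0 := Cardinal.mk_eq_zero PEmpty
        rw [this, Cardinal.power_zero]
        exact Cardinal.one_le_aleph0.trans hμ
      | some i =>
        change ((2 : Cardinal.{u}) ^ #K) ^ #K ≤ _
        rw [← Cardinal.power_mul, Cardinal.mul_eq_self hK]
    simp only [Cardinal.lift_id]
    calc Cardinal.sum (fun a => ((2 : Cardinal.{u}) ^ #K) ^ #(β a))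
        ≤ Cardinal.sum (fun _ : Option ι => (2 : Cardinal.{u}) ^ #K) := Cardinal.sum_le_sum _ _ h1
      _ = #(Option ι) * 2 ^ #K := by simp
      _ ≤ 2 ^ #K * 2 ^ #K := by
        gcongr
        rw [Cardinal.mk_option]
        exact Cardinal.add_le_of_le hμ hι (Cardinal.one_le_aleph0.trans hμ)
      _ = 2 ^ #K := Cardinal.mul_eq_self hμ
  refine ⟨Set.range ev, ⟨WType.mk none (fun x => PEmpty.elim x), rfl⟩,
    Cardinal.mk_range_le.trans hcard, ?_⟩
  intro i f hf
  choose g hg using hf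
  refine ⟨WType.mk (some i) g, ?_⟩
  have : f = fun k => ev (g k) := funext fun k => (hg k).symm
  rw [this]
  rfl

/-- Enumerate a large part of a nonempty set. -/
theorem exists_enum {X P : Type u} (p₀ : X) (Y : Set X) :
    ∃ e : P → X, (Y.Nonempty → (∀ p, e p ∈ Y)) ∧
      (Y.Nonempty → Y ⊆ Set.range e ∨ #P ≤ #↥(Set.range e)) := by
  by_cases hY : Y.Nonempty
  · rcases le_total #↥Y #P with h | h
    · obtain ⟨i⟩ := h
      haveI : Nonempty ↥Y := hY.to_subtype
      refine ⟨fun p => (Function.invFun i p : ↥Y), fun _ p => Subtype.coe_prop _, fun _ => Or.inl ?_⟩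
      intro y hy
      exact ⟨i ⟨y, hy⟩, congrArg Subtype.val (Function.leftInverse_invFun i.injective ⟨y, hy⟩)⟩
    · obtain ⟨i⟩ := h
      refine ⟨fun p => i p, fun _ p => Subtype.coe_prop _, fun _ => Or.inr ?_⟩
      exact (Cardinal.mk_range_eq (fun p => (i p : X)) (Subtype.val_injective.comp i.injective)).ge
  · exact ⟨fun _ => p₀, fun h => absurd h hY, fun h => absurd h hY⟩

theorem charDeg_spec (X : Type u) [TopologicalSpace X] : ℵ₀ ≤ charDeg X ∧
    ∀ x : X, ∃ ℬ : Set (Set X), (∀ B ∈ ℬ, IsOpen B ∧ x ∈ B) ∧ #↥ℬ ≤ charDeg X ∧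
      ∀ U : Set X, IsOpen U → x ∈ U → ∃ B ∈ ℬ, B ⊆ U := by
  refine csInf_mem (s := {κ : Cardinal.{u} | ℵ₀ ≤ κ ∧
    ∀ x : X, ∃ ℬ : Set (Set X), (∀ B ∈ ℬ, IsOpen B ∧ x ∈ B) ∧ #↥ℬ ≤ κ ∧
      ∀ U : Set X, IsOpen U → x ∈ U → ∃ B ∈ ℬ, B ⊆ U}) ⟨max ℵ₀ #(Set X), le_max_left _ _, ?_⟩
  intro x
  exact ⟨{B | IsOpen B ∧ x ∈ B}, fun B hB => hB, (Cardinal.mk_set_le _).trans (le_max_right _ _),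
    fun U hU hx => ⟨U, ⟨hU, hx⟩, subset_rfl⟩⟩

theorem swL_spec (X : Type u) [TopologicalSpace X] (lam : Cardinal.{u}) (hl : 0 < lam) :
    ℵ₀ ≤ swL X lam ∧
    ∀ 𝒰 : Set (Set X), (∀ U ∈ 𝒰, IsOpen U) → Set.univ ⊆ ⋃₀ 𝒰 →
      ∃ 𝒱 ⊆ 𝒰, #↥𝒱 ≤ swL X lam ∧ #↥(Set.univ \ closure (⋃₀ 𝒱)) < lam := by
  refine csInf_mem (s := {κ : Cardinal.{u} | ℵ₀ ≤ κ ∧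
    ∀ 𝒰 : Set (Set X), (∀ U ∈ 𝒰, IsOpen U) → Set.univ ⊆ ⋃₀ 𝒰 →
      ∃ 𝒱 ⊆ 𝒰, #↥𝒱 ≤ κ ∧ #↥(Set.univ \ closure (⋃₀ 𝒱)) < lam})
      ⟨max ℵ₀ #(Set X), le_max_left _ _, ?_⟩
  intro 𝒰 _ hc
  refine ⟨𝒰, subset_rfl, (Cardinal.mk_set_le _).trans (le_max_right _ _), ?_⟩
  have : Set.univ \ closure (⋃₀ 𝒰) = ∅ := Set.diff_eq_empty.2 (hc.trans subset_closure)
  rw [this, Cardinal.mk_emptyCollection]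
  exact hl

/-- In a normal space the skew weak Lindelöf property passes to closed sets. -/
theorem closed_swL {X : Type u} [TopologicalSpace X] [NormalSpace X] (lam : Cardinal.{u})
    (hl : 0 < lam) (C : Set X) (hC : IsClosed C) (𝒰 : Set (Set X)) (ho : ∀ U ∈ 𝒰, IsOpen U)
    (hc : C ⊆ ⋃₀ 𝒰) :
    ∃ 𝒱 ⊆ 𝒰, #↥𝒱 ≤ swL X lam ∧ #↥(C \ closure (⋃₀ 𝒱)) < lam := by
  obtain ⟨V, hVo, hCV, hV⟩ := normal_exists_closure_subset hC (isOpen_sUnion ho) hc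
  obtain ⟨𝒱, h𝒱, hcard, hlt⟩ := (swL_spec X lam hl).2 (insert (closure V)ᶜ 𝒰)
    (by
      rintro U (rfl | hU)
      · exact isClosed_closure.isOpen_compl
      · exact ho U hU)
    (by
      intro x _
      by_cases hx : x ∈ closure V
      · obtain ⟨U, hU, hxU⟩ := hV hx
        exact ⟨U, Or.inr hU, hxU⟩
      · exact ⟨_, Or.inl rfl, hx⟩)
  refine ⟨𝒱 ∩ 𝒰, Set.inter_subset_right,
    (Cardinal.mk_le_mk_of_subset Set.inter_subset_left).trans hcard,
    (Cardinal.mk_le_mk_of_subset ?_).trans_lt hlt⟩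
  rintro x ⟨hxC, hx⟩
  refine ⟨trivial, fun hx' => hx ?_⟩
  rw [mem_closure_iff] at hx' ⊢
  intro O hO hxO
  obtain ⟨y, ⟨hyO, hyV⟩, U, hU, hyU⟩ := hx' (O ∩ V) (hO.inter hVo) ⟨hxO, hCV hxC⟩
  refine ⟨y, hyO, U, ⟨hU, ?_⟩, hyU⟩
  rcases h𝒱 hU with rfl | h
  · exact absurd (subset_closure hyV) hyU
  · exact h

/-- Corollary 5.5: if X is normal (and Hausdorff), then |X| ≤ 2^{swL(X,2^{χ(X)})·χ(X)}. -/
theorem card_le_two_pow_swL_of_normal {X : Type u} [TopologicalSpace X] [T2Space X]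
    [NormalSpace X] :
    #X ≤ 2 ^ (swL X (2 ^ charDeg X) * charDeg X) := by
  classical
  have hl : (0 : Cardinal.{u}) < 2 ^ charDeg X := (Cardinal.zero_le _).trans_lt (Cardinal.cantor _)
  obtain ⟨hχ, hbase⟩ := charDeg_spec X
  have hw := (swL_spec X _ hl).1
  have hclosed := closed_swL (X := X) _ hl
  generalize swL X (2 ^ charDeg X) = τ at *
  generalize charDeg X = χ at *
  have hτκ : τ ≤ τ * χ := Cardinal.le_mul_right (Cardinal.aleph0_pos.trans_le hχ).ne'
  have hχκ : χ ≤ τ * χ := Cardinal.le_mul_left (Cardinal.aleph0_pos.trans_le hw).ne'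
  obtain ⟨K, hK⟩ : ∃ K : Type u, #K = τ * χ := ⟨_, Cardinal.mk_out _⟩
  rw [← hK] at hτκ hχκ ⊢
  haveI : Infinite K := Cardinal.infinite_iff.2 (hχ.trans hχκ)
  rcases isEmpty_or_nonempty X with hX | ⟨⟨p₀⟩⟩
  · rw [Cardinal.mk_eq_zero X]; exact Cardinal.zero_le _
  -- bases indexed by K
  have hb : ∀ x : X, ∃ b : K → Set X, (∀ k, IsOpen (b k) ∧ x ∈ b k) ∧
      ∀ U : Set X, IsOpen U → x ∈ U → ∃ k, b k ⊆ U := by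
    intro x
    obtain ⟨ℬ, h1, h2, h3⟩ := hbase x
    obtain ⟨i⟩ := h2.trans hχκ
    obtain ⟨B0, hB0, _⟩ := h3 Set.univ isOpen_univ trivial
    haveI : Nonempty ↥ℬ := ⟨⟨B0, hB0⟩⟩
    refine ⟨fun k => (Function.invFun i k : ↥ℬ), fun k => h1 _ (Subtype.coe_prop _), ?_⟩
    intro U hU hx
    obtain ⟨B, hB, hBU⟩ := h3 U hU hx
    exact ⟨i ⟨B, hB⟩, by simpa only [Function.leftInverse_invFun i.injective _] using hBU⟩
  choose b hb1 hb2 using hb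
  obtain ⟨e⟩ : Nonempty (K ≃ Finset K) := Cardinal.eq.1 (Cardinal.mk_finset_of_infinite K).symm
  have henum := fun Y : Set X => exists_enum (P := Set K) p₀ Y
  choose en hen1 hen2 using henum
  let lim : (K → X) → X := fun f =>
    if h : ∃ x, Filter.Tendsto (f ∘ e.symm) Filter.atTop (nhds x) then h.choose else p₀
  let F : Option ((K → K) × Set K) → (K → X) → X := fun o f =>
    match o with
    | none => lim f
    | some (j, p) => en (closure (⋃ k, b (f k) (j k)))ᶜ p
  have hK0 : ℵ₀ ≤ #K := Cardinal.aleph0_le_mk K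
  have hμ : ℵ₀ ≤ (2 : Cardinal.{u}) ^ #K := hK0.trans (Cardinal.cantor _).le
  obtain ⟨H, hp₀, hHcard, hH⟩ := exists_closed_under (K := K) (by
    rw [Cardinal.mk_option]
    refine Cardinal.add_le_of_le hμ ?_ (Cardinal.one_le_aleph0.trans hμ)
    have : #((K → K) × Set K) = #K ^ #K * 2 ^ #K := by simp
    rw [this, Cardinal.power_self_eq hK0, Cardinal.mul_eq_self hμ]) p₀ F
  have hHc : IsClosed H := by
    refine isClosed_of_closure_subset fun x hx => ?_
    have : ∀ s : Finset K, ∃ y ∈ H, y ∈ ⋂ k ∈ s, b x k := by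
      intro s
      obtain ⟨y, h1, h2⟩ := mem_closure_iff.1 hx (⋂ k ∈ s, b x k)
        (isOpen_biInter_finset fun k _ => (hb1 x k).1) (Set.mem_iInter₂.2 fun k _ => (hb1 x k).2)
      exact ⟨y, h2, h1⟩
    choose a haH ha using this
    have hlim : Filter.Tendsto ((a ∘ e) ∘ e.symm) Filter.atTop (nhds x) := by
      have : (a ∘ e) ∘ e.symm = a := by ext; simp
      rw [this, Filter.tendsto_def]
      intro U hU
      obtain ⟨O, hOU, hO, hxO⟩ := mem_nhds_iff.1 hU
      obtain ⟨k, hk⟩ := hb2 x O hO hxO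
      filter_upwards [Filter.eventually_ge_atTop ({k} : Finset K)] with s hs
      exact hOU (hk (Set.mem_iInter₂.1 (ha s) k (hs (Finset.mem_singleton_self k))))
    have h := hH none (a ∘ e) (fun k => haH _)
    have hex : ∃ x, Filter.Tendsto ((a ∘ e) ∘ e.symm) Filter.atTop (nhds x) := ⟨x, hlim⟩
    have heq : F none (a ∘ e) = x := by
      change lim (a ∘ e) = x
      simp only [lim]
      rw [dif_pos hex]
      exact tendsto_nhds_unique hex.choose_spec hlim
    rwa [heq] at h
  suffices hall : H = Set.univ by
    rw [hall, Cardinal.mk_univ] at hHcard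
    exact hHcard
  by_contra hne
  obtain ⟨p, hp⟩ := (Set.ne_univ_iff_exists_notMem _).1 hne
  obtain ⟨W, hWo, hHW, hW⟩ := normal_exists_closure_subset hHc
    (isClosed_singleton (x := p)).isOpen_compl (fun x hx => fun h => hp (h ▸ hx))
  have hpW : p ∉ closure W := fun h => hW h rfl
  obtain ⟨𝒱, h𝒱, hcard, hlt⟩ := hclosed H hHc {U | ∃ x ∈ H, ∃ k, U = b x k ∧ b x k ⊆ W}
    (by rintro U ⟨x, _, k, rfl, _⟩; exact (hb1 x k).1)
    (by
      intro x hx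
      obtain ⟨k, hk⟩ := hb2 x W hWo (hHW hx)
      exact ⟨_, ⟨x, hx, k, rfl, hk⟩, (hb1 x k).2⟩)
  -- index the family by K
  obtain ⟨k₀, hk₀⟩ := hb2 p₀ W hWo (hHW hp₀)
  obtain ⟨i⟩ := hcard.trans hτκ
  have hidx : ∀ k : K, ∃ x ∈ H, ∃ j, b x j ⊆ W ∧ ∀ U : ↥𝒱, i U = k → (U : Set X) = b x j := by
    intro k
    by_cases h : ∃ U, i U = k
    · obtain ⟨U, rfl⟩ := h
      obtain ⟨x, hx, j, h1, h2⟩ := h𝒱 U.2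
      exact ⟨x, hx, j, h2, fun U' hU' => by rw [i.injective hU', h1]⟩
    · exact ⟨p₀, hp₀, k₀, hk₀, fun U hU => absurd ⟨U, hU⟩ h⟩
  choose f hfH j hjW hj using hidx
  set O : Set X := ⋃ k, b (f k) (j k) with hO
  have hVO : ⋃₀ 𝒱 ⊆ O := by
    rintro x ⟨U, hU, hx⟩
    refine Set.mem_iUnion.2 ⟨i ⟨U, hU⟩, ?_⟩
    rw [← hj _ ⟨U, hU⟩ rfl]; exact hx
  have hpO : p ∈ (closure O)ᶜ := fun h => hpW (closure_mono (Set.iUnion_subset hjW) h)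
  have hin : Set.range (en (closure O)ᶜ) ⊆ H := by
    rintro _ ⟨q, rfl⟩
    exact hH (some (j, q)) f hfH
  rcases hen2 _ ⟨p, hpO⟩ with h | h
  · exact hp (hin (h hpO))
  · refine absurd hlt (not_lt.2 ?_)
    calc (2 : Cardinal.{u}) ^ χ ≤ 2 ^ #K := Cardinal.power_le_power_left two_ne_zero hχκ
      _ = #(Set K) := (Cardinal.mk_set).symm
      _ ≤ _ := h
      _ ≤ _ := Cardinal.mk_le_mk_of_subset ?_
    rintro x ⟨q, rfl⟩
    exact ⟨hin ⟨q, rfl⟩, fun hx => hen1 _ ⟨p, hpO⟩ q (closure_mono hVO hx)⟩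
end
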